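/- For every n ≥ 1 and every k with 1 ≤ k ≤ n, the number of Dyck paths of semilength n with exactly k peaks equals the Narayana number (1/n)·binom(n, k)·binom(n, k−1); equivalently, n times this number equals binom(n, k)·binom(n, k−1). -/

import Mathlib

/-- A Dyck path of semilength `n`: a sequence of `2n` steps (`true` = ascent `+1`,
`false` = descent `-1`) with all partial sums nonnegative and total sum `0`. -/
def IsDyckPath (n : ℕ) (s : Fin (2*n) → Bool) : Prop :=
  (∀ j : Fin (2*n),
      (Finset.univ.filter (fun i => i ≤ j ∧ s i = false)).card
        ≤ (Finset.univ.filter (fun i => i ≤ j ∧ s i = true)).card) ∧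
  (Finset.univ.filter (fun i => s i = true)).card = n

/-- The number of peaks: positions where an ascent is immediately followed by a descent. -/
def peaks (n : ℕ) (s : Fin (2*n) → Bool) : ℕ :=
  (Finset.univ.filter
    (fun i : Fin (2*n) => s i = true ∧ ∃ j : Fin (2*n), (j : ℕ) = (i : ℕ) + 1 ∧ s j = false)).card

namespace Nara

def toL : (m : ℕ) → (Fin m → Bool) → List Bool
  | 0, _ => []
  | m+1, s => s (Fin.last m) :: toL m (fun i => s i.castSucc)

def good : List Bool → Prop
  | [] => True
  | x :: l => good l ∧ (x :: l).count false ≤ (x :: l).count true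

def pk : List Bool → ℕ
  | [] => 0
  | x :: l => pk l + (if x = false ∧ l.head? = some true then 1 else 0)

def St (a b k : ℕ) (c : Bool) (l : List Bool) : Prop :=
  good l ∧ l.count true = a ∧ l.count false = b ∧ pk l = k ∧ l.headD true = c

open Classical in
noncomputable def F (m : ℕ) (P : List Bool → Prop) : ℤ :=
  ∑ s : Fin m → Bool, if P (toL m s) then 1 else 0

theorem F_zero (P : List Bool → Prop) [Decidable (P [])] : F 0 P = if P [] then 1 else 0 := by
  classical
  simp only [F, toL, Finset.univ_unique, Finset.sum_singleton]
  congr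

theorem F_succ (m : ℕ) (P : List Bool → Prop) :
    F (m+1) P = F m (fun l => P (true :: l)) + F m (fun l => P (false :: l)) := by
  classical
  unfold F
  rw [← (Fin.snocEquiv (fun _ : Fin (m+1) => Bool)).sum_comp, Fintype.sum_prod_type]
  rw [Fintype.sum_bool]
  simp [toL, Fin.snocEquiv]

theorem F_congr {m : ℕ} {P Q : List Bool → Prop} (h : ∀ l, P l ↔ Q l) : F m P = F m Q := by
  have : P = Q := funext fun l => propext (h l)
  rw [this]

theorem F_none {m : ℕ} {P : List Bool → Prop} (h : ∀ l, ¬ P l) : F m P = 0 := by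
  classical
  unfold F
  simp [h]

theorem F_or {m : ℕ} {P Q R : List Bool → Prop} (h : ∀ l, P l ↔ (Q l ∨ R l))
    (h2 : ∀ l, ¬ (Q l ∧ R l)) : F m P = F m Q + F m R := by
  classical
  unfold F
  rw [← Finset.sum_add_distrib]
  refine Finset.sum_congr rfl fun s _ => ?_
  have := h (toL m s)
  have := h2 (toL m s)
  by_cases hq : Q (toL m s) <;> by_cases hr : R (toL m s) <;> simp_all

theorem good_le : ∀ l, good l → l.count false ≤ l.count true
  | [], _ => by simp
  | _ :: _, h => h.2

def h (m : ℕ) : ℕ → ℤ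
  | 0 => 0
  | 1 => 0
  | k+2 => (m.choose k : ℤ)

theorem h_succ (m k : ℕ) : h (m+1) (k+1) = h m (k+1) + h m k := by
  match k with
  | 0 => simp [h]
  | 1 => simp [h]
  | k+2 => simp [h, Nat.choose_succ_succ]; ring

def fU : ℕ → ℕ → ℕ → ℤ
  | _, 0, k => if k = 0 then 1 else 0
  | a, b+1, k => h (a-1) (k+2) * h b (k+1) - h (a-1) (k+1) * h b (k+2)

def fD : ℕ → ℕ → ℕ → ℤ
  | _, 0, _ => 0
  | a, b+1, k => h (a-1) (k+1) * h b (k+1) - h (a-1) k * h b (k+2)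

theorem recU (m a b k : ℕ) (hb : b ≤ a + 1) :
    F (m+1) (St (a+1) b k true) = F m (St a b k true) + F m (St a b k false) := by
  rw [F_succ, F_none (P := fun l => St (a+1) b k true (false :: l)) (by simp [St]), add_zero]
  apply F_or
  · intro l
    cases hl : l.headD true <;> simp only [St, hl] <;> simp [good, pk] <;> grind
  · intro l; simp only [St]; grind

theorem recU0 (m b k : ℕ) : F (m+1) (St 0 b k true) = 0 := by
  rw [F_succ, F_none, F_none, add_zero] <;> simp [St]

theorem recD0 (m a k : ℕ) : F m (St a 0 k false) = 0 := by
  apply F_none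
  intro l
  cases l <;> simp [St]
  intros; grind

theorem St_gt (m a b k : ℕ) (c : Bool) (hab : a < b) : F m (St a b k c) = 0 := by
  apply F_none
  intro l hl
  have := good_le l hl.1
  have := hl.2.1
  have := hl.2.2.1
  omega

theorem recDk0 (m a b : ℕ) (hb : b + 1 ≤ a) :
    F (m+1) (St a (b+1) 0 false) = F m (St a b 0 false) := by
  rw [F_succ, F_none (P := fun l => St a (b+1) 0 false (true :: l)) (by simp [St]), zero_add]
  apply F_congr
  intro l
  match l with
  | [] => simp [St, good, pk] <;> omega
  | true :: l => simp [St, good, pk]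
  | false :: l => simp [St, good, pk] <;> grind

theorem recD (m a b k : ℕ) (hb : b + 1 ≤ a) :
    F (m+1) (St a (b+1) (k+1) false) = F m (St a b (k+1) false) + F m (St a b k true) := by
  rw [F_succ, F_none (P := fun l => St a (b+1) (k+1) false (true :: l)) (by simp [St]), zero_add]
  apply F_or
  · intro l
    match l with
    | [] => simp [St, good, pk] <;> omega
    | true :: l => simp [St, good, pk]; grind
    | false :: l => simp [St, good, pk]; grind
  · intro l; simp only [St]; grind

theorem main (m : ℕ) : ∀ a b k, a + b = m → b ≤ a →
    F m (St a b k true) = fU a b k ∧ F m (St a b k false) = fD a b k := by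
  induction m with
  | zero =>
    intro a b k hm _
    obtain ⟨rfl, rfl⟩ : a = 0 ∧ b = 0 := by omega
    refine ⟨?_, ?_⟩
    · classical
      rw [F_zero]
      simp [St, good, pk, fU, eq_comm]
    · rw [recD0]; rfl
  | succ m ih =>
    intro a b k hm hab
    obtain ⟨a, rfl⟩ : ∃ a', a = a' + 1 := ⟨a - 1, by omega⟩
    constructor
    · rw [recU _ _ _ _ hab]
      rcases Nat.lt_or_ge a b with hlt | hge
      · obtain rfl : b = a + 1 := by omega
        rw [St_gt _ _ _ _ _ hlt, St_gt _ _ _ _ _ hlt]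
        simp [fU]; ring
      · rw [(ih a b k (by omega) hge).1, (ih a b k (by omega) hge).2]
        match b, hge with
        | 0, _ => simp [fU, fD]
        | b+1, hge =>
          obtain ⟨a, rfl⟩ : ∃ a', a = a' + 1 := ⟨a - 1, by omega⟩
          simp only [fU, fD, Nat.add_sub_cancel]
          rw [h_succ a (k+1), h_succ a k]
          ring
    · match b, k with
      | 0, k => rw [recD0]; rfl
      | b+1, 0 =>
        rw [recDk0 _ _ _ hab, (ih (a+1) b 0 (by omega) (by omega)).2]
        cases b <;> simp [fD, h]
      | b+1, k+1 =>
        rw [recD _ _ _ _ hab, (ih (a+1) b (k+1) (by omega) (by omega)).2,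
          (ih (a+1) b k (by omega) (by omega)).1]
        cases b with
        | zero => 
          simp only [fD, fU, Nat.add_sub_cancel]
          match k with
          | 0 => simp [h]
          | k+1 => simp [h]
        | succ b =>
          simp only [fD, fU, Nat.add_sub_cancel]
          rw [h_succ b (k+2), h_succ b (k+1)]
          ring

theorem count_toL (c : Bool) (m : ℕ) (s : Fin m → Bool) :
    (toL m s).count c = (Finset.univ.filter (fun i => s i = c)).card := by
  induction m with
  | zero => simp [toL]
  | succ m ih =>
    rw [toL, List.count_cons, ih, Finset.card_filter, Finset.card_filter, Fin.sum_univ_castSucc]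
    simp

theorem cnt_castSucc (c : Bool) (m : ℕ) (s : Fin (m+1) → Bool) (j : Fin m) :
    (Finset.univ.filter (fun i => i ≤ j.castSucc ∧ s i = c)).card
      = (Finset.univ.filter (fun i => i ≤ j ∧ s i.castSucc = c)).card := by
  rw [Finset.card_filter, Finset.card_filter, Fin.sum_univ_castSucc]
  have : ¬ (Fin.last m ≤ j.castSucc) := by
    simp [Fin.le_def]
  simp [this]

theorem cnt_last (c : Bool) (m : ℕ) (s : Fin (m+1) → Bool) :
    (Finset.univ.filter (fun i => i ≤ Fin.last m ∧ s i = c)).card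
      = (toL (m+1) s).count c := by
  rw [count_toL]
  simp [Fin.le_last]

theorem good_toL (m : ℕ) (s : Fin m → Bool) :
    good (toL m s) ↔ ∀ j : Fin m,
      (Finset.univ.filter (fun i => i ≤ j ∧ s i = false)).card
        ≤ (Finset.univ.filter (fun i => i ≤ j ∧ s i = true)).card := by
  induction m with
  | zero => simp [toL, good]
  | succ m ih =>
    rw [Fin.forall_fin_succ', cnt_last, cnt_last]
    simp only [cnt_castSucc]
    rw [← ih (fun i => s i.castSucc)]
    rfl

theorem pk_toL (m : ℕ) (s : Fin m → Bool) :
    pk (toL m s) = (Finset.univ.filter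
      (fun i : Fin m => s i = true ∧ ∃ j : Fin m, (j : ℕ) = (i : ℕ) + 1 ∧ s j = false)).card := by
  induction m with
  | zero => simp [toL, pk]
  | succ m ih =>
    rw [toL, pk, ih, Finset.card_filter, Finset.card_filter, Fin.sum_univ_castSucc]
    have h0 : ¬ ∃ j : Fin (m+1), (j : ℕ) = (Fin.last m : ℕ) + 1 ∧ s j = false := by
      rintro ⟨j, hj, -⟩
      have := j.2
      simp at hj
      omega
    have h1 : ¬ (s (Fin.last m) = true ∧ ∃ j : Fin (m+1), (j : ℕ) = (Fin.last m : ℕ) + 1 ∧ s j = false) := fun hh => h0 hh.2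
    rw [if_neg h1, add_zero]
    cases m with
    | zero => simp [toL]
    | succ m =>
      rw [Fin.sum_univ_castSucc, Fin.sum_univ_castSucc (n := m), add_assoc]
      congr 1
      · refine Finset.sum_congr rfl fun i _ => ?_
        refine if_congr (and_congr Iff.rfl ?_) rfl rfl
        conv_rhs => rw [Fin.exists_fin_succ']
        have := i.2
        simp
        intro hh
        omega
      · have h2 : ¬ (s (Fin.last m).castSucc = true ∧ ∃ j : Fin (m+1), (j : ℕ) = (Fin.last m : ℕ) + 1 ∧ s j.castSucc = false) := by
          rintro ⟨-, j, hj, -⟩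
          have := j.2
          simp at hj
          omega
        rw [if_neg h2, zero_add]
        · refine if_congr ?_ rfl rfl
          simp only [toL, List.head?_cons, Option.some.injEq]
          constructor
          · rintro ⟨h1, h2⟩
            exact ⟨h2, Fin.last _, by simp, h1⟩
          · rintro ⟨h1, j, hj, h2⟩
            have : j = Fin.last _ := by ext; simpa using hj
            subst this
            exact ⟨h2, h1⟩

theorem count_add (m : ℕ) (s : Fin m → Bool) :
    (toL m s).count true + (toL m s).count false = m := by
  induction m with
  | zero => simp [toL]
  | succ m ih =>
    have := ih (fun i => s i.castSucc)
    rw [toL, List.count_cons, List.count_cons]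
    cases s (Fin.last m) <;> simp <;> omega

theorem binom (m j : ℕ) :
    ((m:ℤ)+1) * (h m (j+2) * h m (j+2) - h m (j+1) * h m (j+3))
      = ((m+1).choose (j+1) : ℤ) * ((m+1).choose j : ℤ) := by
  have hm : ((m:ℤ)+1) ≠ 0 := by positivity
  cases j with
  | zero => simp [h]
  | succ j =>
    simp only [h]
    have e1 := Nat.add_one_mul_choose_eq m (j+1)
    have e2 := Nat.add_one_mul_choose_eq m j
    have p1 := Nat.choose_succ_succ m (j+1)
    have p2 := Nat.choose_succ_succ m j
    simp only [Nat.succ_eq_add_one] at p1 p2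
    zify at e1 e2 p1 p2
    set A : ℤ := (m.choose j : ℤ)
    set B : ℤ := (m.choose (j+1) : ℤ)
    set C : ℤ := (m.choose (j+1+1) : ℤ)
    set X : ℤ := ((m+1).choose (j+1+1) : ℤ)
    set Y : ℤ := ((m+1).choose (j+1) : ℤ)
    have e3 : ((m:ℤ)+1) * C = ((m:ℤ) - j - 1) * X := by
      linear_combination -(m+1:ℤ) * p1 - e1
    have e4 : ((m:ℤ)+1) * B = ((m:ℤ) - j) * Y := by
      linear_combination -(m+1:ℤ) * p2 - e2
    apply mul_left_cancel₀ hm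
    linear_combination ((m:ℤ)+1) * B * e1 + (j+2) * X * e4 - ((m:ℤ)+1) * C * e2 - (j+1) * Y * e3

end Nara

open Nara in
/-- The number of Dyck paths of semilength `n` with exactly `k` peaks equals the
Narayana number `(1/n)·binom(n,k)·binom(n,k-1)`, stated in the cross-multiplied form. -/
theorem card_dyckPath_peaks (n k : ℕ) (hn : 1 ≤ n) (hk1 : 1 ≤ k) (hkn : k ≤ n) :
    n * Nat.card {s : Fin (2*n) → Bool // IsDyckPath n s ∧ peaks n s = k}
      = Nat.choose n k * Nat.choose n (k - 1) := by
  classical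
  have key : (Nat.card {s : Fin (2*n) → Bool // IsDyckPath n s ∧ peaks n s = k} : ℤ)
      = F (2*n) (fun l => St n n k true l ∨ St n n k false l) := by
    rw [Nat.card_eq_fintype_card, Fintype.card_subtype, Finset.card_filter]
    unfold F
    push_cast
    refine Finset.sum_congr rfl fun s _ => ?_
    suffices hiff : (IsDyckPath n s ∧ peaks n s = k) ↔
        (St n n k true (toL (2*n) s) ∨ St n n k false (toL (2*n) s)) by
      by_cases hd : IsDyckPath n s ∧ peaks n s = k
      · rw [if_pos hd, if_pos (hiff.1 hd)]
      · rw [if_neg hd, if_neg (fun hh => hd (hiff.2 hh))]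
    have hc := count_add _ s
    unfold IsDyckPath peaks
    rw [← pk_toL, ← good_toL, ← count_toL]
    cases hl : (toL (2*n) s).headD true <;> simp only [St, hl] <;> grind
  obtain ⟨n, rfl⟩ : ∃ a', n = a' + 1 := ⟨n - 1, by omega⟩
  obtain ⟨k, rfl⟩ : ∃ a', k = a' + 1 := ⟨k - 1, by omega⟩
  rw [F_or (fun _ => Iff.rfl) (by intro l; simp only [St]; grind)] at key
  have hm := main (2*(n+1)) (n+1) (n+1) (k+1) (by omega) le_rfl
  rw [hm.1, hm.2] at key
  apply Nat.cast_injective (R := ℤ)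
  rw [Nat.cast_mul, key]
  have := binom n k
  simp only [fU, fD, Nat.add_sub_cancel]
  push_cast
  linear_combination this
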